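/- Let k ≥ 3 and let n_1, …, n_k ≥ 1 and n'_1, …, n'_k ≥ 1 be integers. Suppose there exist positive integers K and L and a permutation σ of {1,…,k} such that K(n_i − 1) = L(n'_{σ(i)} − 1) for all i (i.e., the Euler characteristic vectors with entries χ_i = (1−n_i)/4 and χ'_i = (1−n'_i)/4 are commensurable vectors). Then the right-angled Coxeter groups W_{Θ(n_1,…,n_k)} and W_{Θ(n'_1,…,n'_k)} are abstractly commensurable. -/

import Mathlib

open scoped Classical

/-- Vertices of the generalized Θ-graph `Θ(n 0, …, n (k-1))`: two essential vertices
(`Sum.inl true` and `Sum.inl false`) together with `n i` interior vertices on the `i`-th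
path. -/
abbrev ThetaVertex {k : ℕ} (n : Fin k → ℕ) : Type :=
  Bool ⊕ (Σ i : Fin k, Fin (n i))

/-- Adjacency in the generalized Θ-graph: the essential vertex `true` is adjacent to the
first interior vertex of each path, the essential vertex `false` to the last, and
consecutive interior vertices of a common path are adjacent. -/
def ThetaAdj {k : ℕ} (n : Fin k → ℕ) : ThetaVertex n → ThetaVertex n → Prop
  | Sum.inl _, Sum.inl _ => False
  | Sum.inl e, Sum.inr ⟨i, j⟩ => (e = true ∧ (j : ℕ) = 0) ∨ (e = false ∧ (j : ℕ) = n i - 1)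
  | Sum.inr ⟨i, j⟩, Sum.inl e => (e = true ∧ (j : ℕ) = 0) ∨ (e = false ∧ (j : ℕ) = n i - 1)
  | Sum.inr ⟨i, j⟩, Sum.inr ⟨i', j'⟩ =>
      (i : ℕ) = (i' : ℕ) ∧ ((j' : ℕ) = (j : ℕ) + 1 ∨ (j : ℕ) = (j' : ℕ) + 1)

/-- The right-angled Coxeter relators of a graph: `v²` for each vertex `v` and `(uv)²` for
each pair of adjacent vertices. -/
def racgRelators {V : Type} (adj : V → V → Prop) : Set (FreeGroup V) :=
  {w | (∃ v, w = FreeGroup.of v ^ 2) ∨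
    ∃ u v, adj u v ∧ w = (FreeGroup.of u * FreeGroup.of v) ^ 2}

/-- The right-angled Coxeter group of a graph given by its adjacency relation. -/
abbrev RACG {V : Type} (adj : V → V → Prop) : Type :=
  PresentedGroup (racgRelators adj)

/-- The right-angled Coxeter group `W_{Θ(n 0, …, n (k-1))}` with nerve the generalized
Θ-graph. -/
abbrev ThetaRACG {k : ℕ} (n : Fin k → ℕ) : Type :=
  RACG (ThetaAdj n)

/-- The linear degree of `Θ(n 0, …, n (k-1))`: the number of paths with one interior
vertex. -/
noncomputable def linearDegree {k : ℕ} (n : Fin k → ℕ) : ℕ :=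
  (Finset.univ.filter fun i => n i = 1).card
/-- Groups `G` and `H` are abstractly commensurable if they have isomorphic finite-index
subgroups. -/
def AbstractlyCommensurable (G H : Type) [Group G] [Group H] : Prop :=
  ∃ (G' : Subgroup G) (H' : Subgroup H),
    G'.FiniteIndex ∧ H'.FiniteIndex ∧ Nonempty (G' ≃* H')
namespace ThetaRACG

variable {k : ℕ} {n : Fin k → ℕ}

/-- The generator of an essential vertex. -/
def ess (n : Fin k → ℕ) (e : Bool) : ThetaRACG n :=
  PresentedGroup.of (Sum.inl e)

/-- The generator of the `q`-th interior vertex of the `i`-th path, and `1` if there is no such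
vertex. -/
noncomputable def inner (n : Fin k → ℕ) (i : Fin k) (q : ℕ) : ThetaRACG n :=
  if h : q < n i then PresentedGroup.of (Sum.inr ⟨i, ⟨q, h⟩⟩) else 1

theorem inner_of_lt {i : Fin k} {q : ℕ} (h : q < n i) :
    inner n i q = PresentedGroup.of (Sum.inr ⟨i, ⟨q, h⟩⟩) := dif_pos h

theorem of_mul_self {V : Type} {adj : V → V → Prop} (v : V) :
    (PresentedGroup.of v : RACG adj) * PresentedGroup.of v = 1 := by
  have h : PresentedGroup.mk (racgRelators adj) (FreeGroup.of v ^ 2) = 1 :=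
    PresentedGroup.one_of_mem (Or.inl ⟨v, rfl⟩)
  rwa [pow_two, map_mul] at h

theorem commute_of_mul_self_eq_one {G : Type*} [Group G] {x y : G} (hx : x * x = 1)
    (hy : y * y = 1) (h : (x * y) ^ 2 = 1) : Commute x y := by
  rw [pow_two] at h
  have h' := eq_inv_of_mul_eq_one_left h
  rwa [mul_inv_rev, ← eq_inv_of_mul_eq_one_left hx, ← eq_inv_of_mul_eq_one_left hy] at h'

theorem commute_of {V : Type} {adj : V → V → Prop} {u v : V} (huv : adj u v) :
    Commute (PresentedGroup.of u : RACG adj) (PresentedGroup.of v) := by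
  refine commute_of_mul_self_eq_one (of_mul_self u) (of_mul_self v) ?_
  have h : PresentedGroup.mk (racgRelators adj) ((FreeGroup.of u * FreeGroup.of v) ^ 2) = 1 :=
    PresentedGroup.one_of_mem (Or.inr ⟨u, v, huv, rfl⟩)
  rwa [map_pow, map_mul] at h

theorem ess_mul_self (e : Bool) : ess n e * ess n e = 1 := of_mul_self _

theorem inner_mul_self (i : Fin k) (q : ℕ) : inner n i q * inner n i q = 1 := by
  unfold inner
  split_ifs
  · exact of_mul_self _
  · simp

theorem commute_inner_succ (i : Fin k) (q : ℕ) :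
    Commute (inner n i q) (inner n i (q + 1)) := by
  unfold inner
  split_ifs
  · exact commute_of ⟨rfl, Or.inl rfl⟩
  all_goals simp

theorem commute_ess_true (i : Fin k) : Commute (ess n true) (inner n i 0) := by
  unfold inner ess
  split_ifs
  · exact commute_of (Or.inl ⟨rfl, rfl⟩)
  · simp

theorem commute_ess_false (i : Fin k) : Commute (ess n false) (inner n i (n i - 1)) := by
  unfold inner ess
  split_ifs
  · exact commute_of (Or.inr ⟨rfl, rfl⟩)
  · simp

/-- The homomorphism out of `W_Θ` determined by commuting involutions. -/
theorem exists_lift {G : Type*} [Group G] (x : Bool → G) (y : Fin k → ℕ → G)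
    (hx : ∀ e, x e * x e = 1) (hy : ∀ i q, q < n i → y i q * y i q = 1)
    (hyy : ∀ i q, q + 1 < n i → Commute (y i q) (y i (q + 1)))
    (hxt : ∀ i, 0 < n i → Commute (x true) (y i 0))
    (hxf : ∀ i, 0 < n i → Commute (x false) (y i (n i - 1))) :
    ∃ f : ThetaRACG n →* G, (∀ e, f (ess n e) = x e) ∧
      ∀ i q, q < n i → f (inner n i q) = y i q := by
  let g : ThetaVertex n → G := Sum.elim x fun v => y v.1 v.2
  have hg : ∀ v, g v * g v = 1 := by
    rintro (e | ⟨i, j⟩)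
    · exact hx e
    · exact hy i j j.2
  have hcomm : ∀ u v, ThetaAdj n u v → Commute (g u) (g v) := by
    have key : ∀ e i (j : Fin (n i)),
        ((e = true ∧ (j : ℕ) = 0) ∨ (e = false ∧ (j : ℕ) = n i - 1)) →
          Commute (x e) (y i j) := by
      rintro e i j (⟨rfl, h⟩ | ⟨rfl, h⟩)
      · rw [h]
        exact hxt i j.pos
      · rw [h]
        exact hxf i j.pos
    rintro (e | ⟨i, j⟩) (e' | ⟨i', j'⟩) h
    · exact h.elim
    · exact key e i' j' h
    · exact (key e' i j h).symm
    · obtain ⟨hi, h⟩ := h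
      obtain rfl := Fin.ext hi
      change Commute (y i j) (y i j')
      rcases h with h | h
      · rw [h]
        exact hyy i j (h ▸ j'.2)
      · rw [h]
        exact (hyy i j' (h ▸ j.2)).symm
  have hrel : ∀ r ∈ racgRelators (ThetaAdj n), FreeGroup.lift g r = 1 := by
    rintro r (⟨v, rfl⟩ | ⟨u, v, huv, rfl⟩)
    · simp [pow_two, hg]
    · rw [map_pow, map_mul, FreeGroup.lift_apply_of, FreeGroup.lift_apply_of,
        (hcomm u v huv).mul_pow, pow_two, pow_two, hg, hg, one_mul]
  refine ⟨PresentedGroup.toGroup hrel, fun e => ?_, fun i q hq => ?_⟩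
  · exact PresentedGroup.toGroup.of hrel
  · rw [inner_of_lt hq]
    exact PresentedGroup.toGroup.of hrel

theorem closure_generators :
    Subgroup.closure (Set.range (ess n) ∪ {g | ∃ i q, q < n i ∧ inner n i q = g}) = ⊤ := by
  rw [eq_top_iff, ← PresentedGroup.closure_range_of, Subgroup.closure_le]
  rintro _ ⟨e | ⟨i, j⟩, rfl⟩
  · exact Subgroup.subset_closure (Or.inl ⟨e, rfl⟩)
  · exact Subgroup.subset_closure (Or.inr ⟨i, j, j.2, inner_of_lt j.2⟩)

/-- In the row of `d` polygons obtained by unfolding alternately along the two essential walls, the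
`p`-th wall of the `j`-th polygon is the wall with this index in the unfolded polygon; here a polygon
has `N + 1` interior walls. -/
def pos (N j p : ℕ) : ℕ :=
  j * N + if j.bodd then N - p else p

/-- The action of an essential generator on `G × ℕ`: it moves between adjacent polygons of the row
`0, …, d - 1`, and multiplies by `A` or by `B` at the two ends of the row. -/
def step {G : Type*} [Group G] (A B : G) (d : ℕ) (e : Bool) (x : G × ℕ) : G × ℕ :=
  if x.2 < d then
    if e = x.2.bodd then
      if x.2 + 1 < d then (x.1, x.2 + 1) else (B * x.1, x.2)
    else if x.2 = 0 then (A * x.1, 0) else (x.1, x.2 - 1)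
  else x

theorem step_involutive {G : Type*} [Group G] {A B : G} (hA : A * A = 1) (hB : B * B = 1)
    (d : ℕ) (e : Bool) : Function.Involutive (step A B d e) := by
  rintro ⟨x, j⟩
  by_cases hj : j < d
  · by_cases he : e = j.bodd
    · by_cases hj' : j + 1 < d
      · simp [step, hj, he, hj']
      · simp [step, hj, he, hj', ← mul_assoc, hB]
    · rcases j with _ | j
      · have : e = true := by simpa using he
        simp [step, hj, this, ← mul_assoc, hA]
      · have he' : e = j.bodd := by simpa using he
        simp [step, hj, he', show j < d by omega]
  · simp [step, hj]

theorem pos_bodd (N j : ℕ) : pos N j (if j.bodd then 0 else N) = (j + 1) * N := by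
  cases h : j.bodd <;> simp [pos, h, add_mul]

theorem pos_succ_bodd (N j : ℕ) : pos N (j + 1) (if j.bodd then 0 else N) = (j + 1) * N := by
  cases h : j.bodd <;> simp [pos, h]

theorem exists_pos_eq {N c q : ℕ} (hq : q ≤ (c + 1) * N) :
    ∃ j p, j < c + 1 ∧ p ≤ N ∧ q = pos N j p := by
  obtain ⟨j, r, hj, hr, rfl⟩ : ∃ j r, j < c + 1 ∧ r ≤ N ∧ q = j * N + r := by
    induction c with
    | zero => exact ⟨0, q, by omega, by omega, by omega⟩
    | succ c ih =>
      rcases le_total q ((c + 1) * N) with h | h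
      · obtain ⟨j, r, hj, hr⟩ := ih h
        exact ⟨j, r, by omega, hr⟩
      · rw [add_mul _ 1] at hq
        exact ⟨c + 1, q - (c + 1) * N, by omega, by omega, by omega⟩
  refine ⟨j, if j.bodd then N - r else r, hj, by split_ifs <;> omega, ?_⟩
  unfold pos
  split_ifs <;> omega

/-- The action on `G × ℕ` that multiplies the fibre over `j` by `u j`. -/
def fiberMul {G : Type*} [Group G] (u : ℕ → G) (x : G × ℕ) : G × ℕ :=
  (u x.2 * x.1, x.2)

theorem fiberMul_involutive {G : Type*} [Group G] {u : ℕ → G} (hu : ∀ j, u j * u j = 1) :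
    Function.Involutive (fiberMul u) := fun x => by
  simp [fiberMul, ← mul_assoc, hu]

theorem fiberMul_comm {G : Type*} [Group G] {u v : ℕ → G} (h : ∀ j, Commute (u j) (v j))
    (x : G × ℕ) : fiberMul u (fiberMul v x) = fiberMul v (fiberMul u x) := by
  simp [fiberMul, ← mul_assoc, (h x.2).eq]

theorem step_fiberMul_comm {G : Type*} [Group G] {A B : G} {c : ℕ} {e : Bool} {u : ℕ → G}
    (hA : e = true → Commute A (u 0)) (hB : e = c.bodd → Commute B (u c))
    (hu : ∀ j, e = j.bodd → u j = u (j + 1)) (x : G × ℕ) :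
    step A B (c + 1) e (fiberMul u x) = fiberMul u (step A B (c + 1) e x) := by
  obtain ⟨x, j⟩ := x
  by_cases hj : j < c + 1
  · by_cases he : e = j.bodd
    · by_cases hj' : j + 1 < c + 1
      · have := hu j he
        subst he
        simp [step, fiberMul, hj, show j < c by omega, this]
      · obtain rfl : j = c := by omega
        have := (hB he).eq
        subst he
        simp [step, fiberMul, ← mul_assoc, this]
    · rcases j with _ | j
      · have he' : e = true := by simpa using he
        have := (hA he').eq
        subst he'
        simp [step, fiberMul, ← mul_assoc, this]
      · have he' : e = j.bodd := by simpa using he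
        have := hu j he'
        subst he'
        simp [step, fiberMul, show j < c by omega, this]
  · simp [step, fiberMul, hj]

/-- The product of the essential walls crossed on the way from polygon `0` to polygon `j`. -/
def crossing (n : Fin k → ℕ) : ℕ → ThetaRACG n
  | 0 => 1
  | j + 1 => ess n j.bodd * crossing n j

/-- The copy of the `p`-th wall of the `i`-th path in the `j`-th polygon of the unfolded row, where
the walls are counted from the side of polygon `0`. -/
noncomputable def wall (n : Fin k → ℕ) (i : Fin k) (j p : ℕ) : ThetaRACG n :=
  (crossing n j)⁻¹ * inner n i (if j.bodd then n i - 1 - p else p) * crossing n j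

theorem wall_mul_self (i : Fin k) (j p : ℕ) : wall n i j p * wall n i j p = 1 := by
  have := inner_mul_self (n := n) i (if j.bodd then n i - 1 - p else p)
  unfold wall
  generalize inner n i _ = v at *
  calc _ = (crossing n j)⁻¹ * (v * v) * crossing n j := by group
    _ = 1 := by simp [this]

theorem conj_commute {G : Type*} [Group G] {x y : G} (r : G) (h : Commute x y) :
    Commute (r⁻¹ * x * r) (r⁻¹ * y * r) := by
  have := h.conj r⁻¹
  simpa using this

theorem commute_ess_bodd (i : Fin k) (j : ℕ) :
    Commute (ess n j.bodd) (inner n i (if j.bodd then 0 else n i - 1)) := by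
  cases j.bodd
  · simpa using commute_ess_false i
  · simpa using commute_ess_true i

theorem wall_succ_zero (i : Fin k) (j : ℕ) : wall n i (j + 1) 0 = wall n i j (n i - 1) := by
  have h := commute_ess_bodd (n := n) i j
  have e1 : (if (j + 1).bodd then n i - 1 - 0 else 0) = if j.bodd then 0 else n i - 1 := by
    cases hj : j.bodd <;> simp [hj]
  have e2 : (if j.bodd then n i - 1 - (n i - 1) else n i - 1) = if j.bodd then 0 else n i - 1 := by
    simp
  unfold wall
  rw [e1, e2, crossing, mul_inv_rev, mul_assoc _ (ess n j.bodd)⁻¹, h.inv_left.eq]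
  simp only [mul_assoc, inv_mul_cancel_left]

theorem commute_wall_succ (i : Fin k) (j p : ℕ) (hp : p + 1 < n i) :
    Commute (wall n i j p) (wall n i j (p + 1)) := by
  apply conj_commute
  split_ifs
  · have := (commute_inner_succ (n := n) i (n i - 1 - (p + 1))).symm
    rwa [show n i - 1 - (p + 1) + 1 = n i - 1 - p by omega] at this
  · exact commute_inner_succ i p

theorem wall_div_mod (i : Fin k) (j p : ℕ) (hp : p < n i) :
    wall n i ((j * (n i - 1) + p) / (n i - 1)) ((j * (n i - 1) + p) % (n i - 1)) =
      wall n i j p := by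
  rcases Nat.eq_zero_or_pos (n i - 1) with h | h
  · obtain rfl : p = 0 := by omega
    rw [h]
    induction j with
    | zero => simp
    | succ j ih => rw [wall_succ_zero, h, ← ih]; simp
  · rcases Nat.lt_or_ge p (n i - 1) with hp' | hp'
    · rw [mul_comm j, Nat.mul_add_div h, Nat.mul_add_mod, Nat.div_eq_of_lt hp',
        Nat.mod_eq_of_lt hp', add_zero]
    · obtain rfl : p = n i - 1 := by omega
      rw [mul_comm j, Nat.mul_add_div h, Nat.mul_add_mod, Nat.div_self h, Nat.mod_self,
        wall_succ_zero]

/-- Unfolding `d` copies of the defining polygons embeds `W_{Θ(m)}` with finite index into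
`W_{Θ(n)}` whenever `m - 1 = d (n - 1)` up to a permutation of the paths. -/
theorem exists_embedding (n m : Fin k → ℕ) (hn : ∀ i, 1 ≤ n i) (d : ℕ) (hd : 0 < d)
    (τ : Equiv.Perm (Fin k)) (hm : ∀ i, m (τ i) = 1 + d * (n i - 1)) :
    ∃ f : ThetaRACG m →* ThetaRACG n, Function.Injective f ∧ f.range.FiniteIndex := by
  obtain ⟨c, rfl⟩ : ∃ c, d = c + 1 := ⟨d - 1, by omega⟩
  -- the embedding
  let B : ThetaRACG n := (crossing n c)⁻¹ * ess n c.bodd * crossing n c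
  let y : Fin k → ℕ → ThetaRACG n := fun i q =>
    wall n (τ.symm i) (q / (n (τ.symm i) - 1)) (q % (n (τ.symm i) - 1))
  have hy : ∀ i j p, p < n i → y (τ i) (j * (n i - 1) + p) = wall n i j p := by
    intro i j p hp
    simpa [y] using wall_div_mod i j p hp
  have hB : B * B = 1 := by
    have := ess_mul_self (n := n) c.bodd
    calc B * B = (crossing n c)⁻¹ * (ess n c.bodd * ess n c.bodd) * crossing n c := by
          simp only [B]; group
      _ = 1 := by simp [this]
  obtain ⟨f, hfe, hfi⟩ := exists_lift (n := m) (fun e => if e then ess n true else B) y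
    (by rintro (_ | _); exacts [hB, ess_mul_self true])
    (fun i q _ => wall_mul_self _ _ _)
    (by
      intro i q hq
      obtain ⟨i, rfl⟩ := τ.surjective i
      rw [hm] at hq
      have hN : 0 < n i - 1 := by
        rcases Nat.eq_zero_or_pos (n i - 1) with h | h
        · simp [h] at hq
        · exact h
      have hlt := Nat.mod_lt q hN
      have hq' : q = q / (n i - 1) * (n i - 1) + q % (n i - 1) := by
        rw [mul_comm]; exact (Nat.div_add_mod _ _).symm
      generalize q / (n i - 1) = j at *
      generalize q % (n i - 1) = p at *
      subst hq'
      rw [add_assoc, hy i j p (by omega), hy i j (p + 1) (by omega)]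
      exact commute_wall_succ i j p (by omega))
    (by
      intro i _
      obtain ⟨i, rfl⟩ := τ.surjective i
      have := hy i 0 0 (hn i)
      simp only [zero_mul, add_zero] at this
      rw [this]
      simpa [wall, crossing] using commute_ess_true i)
    (by
      intro i _
      obtain ⟨i, rfl⟩ := τ.surjective i
      have hi := hn i
      have := hy i c (n i - 1) (by omega)
      rw [hm, Nat.add_sub_cancel_left, add_mul, one_mul, this]
      apply conj_commute
      simpa using commute_ess_bodd (n := n) i c)
  have hfw : ∀ i j p, j < c + 1 → p < n i →
      f (inner m (τ i) (j * (n i - 1) + p)) = wall n i j p := by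
    intro i j p hj hp
    rw [hfi, hy i j p hp]
    rw [hm]
    have : (j + 1) * (n i - 1) ≤ (c + 1) * (n i - 1) := Nat.mul_le_mul_right _ hj
    rw [add_mul] at this
    omega
  have hfv : ∀ i j p, j < c + 1 → p < n i →
      inner n i p * crossing n j = crossing n j * f (inner m (τ i) (pos (n i - 1) j p)) := by
    intro i j p hj hp
    unfold pos
    rw [hfw i j _ hj (by split_ifs <;> omega), wall]
    have : (if j.bodd then n i - 1 - (if j.bodd then n i - 1 - p else p)
        else (if j.bodd then n i - 1 - p else p)) = p := by
      split_ifs <;> omega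
    rw [this]
    group
  -- the action of the ambient group on the union of the `c + 1` cosets
  have hms := ess_mul_self (n := m)
  have hu : ∀ i p j, inner m (τ i) (pos (n i - 1) j p) * inner m (τ i) (pos (n i - 1) j p) = 1 :=
    fun _ _ _ => inner_mul_self _ _
  have hcomm : ∀ i e x, step (ess m true) (ess m false) (c + 1) e
      (fiberMul (fun j => inner m (τ i) (pos (n i - 1) j (if e then 0 else n i - 1))) x) =
      fiberMul (fun j => inner m (τ i) (pos (n i - 1) j (if e then 0 else n i - 1)))
        (step (ess m true) (ess m false) (c + 1) e x) := by
    intro i e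
    apply step_fiberMul_comm
    · rintro rfl
      simpa [pos] using commute_ess_true (n := m) (τ i)
    · rintro rfl
      have := commute_ess_false (n := m) (τ i)
      rwa [hm, Nat.add_sub_cancel_left, ← pos_bodd] at this
    · rintro j rfl
      rw [pos_bodd, pos_succ_bodd]
  obtain ⟨Φ, hΦe, hΦi⟩ := exists_lift (n := n) (G := Equiv.Perm (ThetaRACG m × ℕ))
    (fun e => (step_involutive (hms true) (hms false) (c + 1) e).toPerm)
    (fun i p => (fiberMul_involutive (hu i p)).toPerm)
    (fun e => Equiv.ext (step_involutive (hms true) (hms false) (c + 1) e))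
    (fun i p _ => Equiv.ext (fiberMul_involutive (hu i p)))
    (by
      intro i q hq
      refine Equiv.ext (fiberMul_comm (u := fun j => inner m (τ i) (pos (n i - 1) j q))
        (v := fun j => inner m (τ i) (pos (n i - 1) j (q + 1))) fun j => ?_)
      unfold pos
      split_ifs
      · have := (commute_inner_succ (n := m) (τ i) (j * (n i - 1) + (n i - 1 - (q + 1)))).symm
        rwa [show j * (n i - 1) + (n i - 1 - (q + 1)) + 1 = j * (n i - 1) + (n i - 1 - q)
          by omega] at this
      · exact commute_inner_succ (n := m) (τ i) (j * (n i - 1) + q))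
    (fun i _ => Equiv.ext (hcomm i true))
    (fun i _ => Equiv.ext (hcomm i false))
  have hΦr : ∀ j, j < c + 1 → ∀ x, Φ (crossing n j) (x, 0) = (x, j) := by
    intro j
    induction j with
    | zero => simp [crossing]
    | succ j ih =>
      intro hj x
      rw [crossing, map_mul, Equiv.Perm.mul_apply, ih (by omega), hΦe]
      simp [step, hj, show j < c + 1 by omega]
  have hΦr' : ∀ j, j < c + 1 → ∀ x, Φ (crossing n j)⁻¹ (x, j) = (x, 0) := by
    intro j hj x
    rw [map_inv, Equiv.Perm.inv_eq_iff_eq, hΦr j hj]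
  have hΦf : ∀ w x, Φ (f w) (x, 0) = (w * x, 0) := by
    intro w
    have hw : w ∈ Subgroup.closure
      (Set.range (ess m) ∪ {g | ∃ i q, q < m i ∧ inner m i q = g}) := by
        rw [closure_generators]; trivial
    induction hw using Subgroup.closure_induction with
    | mem w hw =>
      intro x
      rcases hw with ⟨e, rfl⟩ | ⟨i, q, hq, rfl⟩
      · rw [hfe]
        cases e
        · simp only [Bool.false_eq_true, if_false, B, map_mul, Equiv.Perm.mul_apply]
          rw [hΦr c (by omega), hΦe]
          simp [step, hΦr' c (by omega), -map_inv]
        · simp [hΦe, step]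
      · obtain ⟨i, rfl⟩ := τ.surjective i
        obtain ⟨j, p, hj, hp, rfl⟩ : ∃ j p, j < c + 1 ∧ p < n i ∧ q = pos (n i - 1) j p := by
          rw [hm] at hq
          have hi := hn i
          obtain ⟨j, p, hj, hp, rfl⟩ := exists_pos_eq (N := n i - 1) (c := c) (q := q) (by omega)
          exact ⟨j, p, hj, by omega, rfl⟩
        have h := hfv i j p hj hp
        rw [← inv_mul_eq_iff_eq_mul] at h
        rw [← h, map_mul, map_mul, Equiv.Perm.mul_apply, Equiv.Perm.mul_apply, hΦr j hj,
          hΦi i p hp]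
        simp [fiberMul, hΦr' j hj, -map_inv]
    | one => simp
    | mul a b _ _ ha hb => intro x; simp [ha, hb, mul_assoc]
    | inv a _ ha =>
      intro x
      rw [map_inv, map_inv, Equiv.Perm.inv_eq_iff_eq, ha, mul_inv_cancel_left]
  refine ⟨f, ?_, ?_⟩
  · intro w w' h
    have h1 := hΦf w 1
    rw [h, hΦf] at h1
    simpa using h1.symm
  · have hcover : ∀ g : ThetaRACG n, ∃ j, j < c + 1 ∧ ∃ w, g = crossing n j * f w := by
      have hess : ∀ e j, j < c + 1 → ∃ j', j' < c + 1 ∧ ∃ w,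
          ess n e * crossing n j = crossing n j' * f w := by
        intro e j hj
        by_cases he : e = j.bodd
        · subst he
          by_cases hj' : j + 1 < c + 1
          · exact ⟨j + 1, hj', 1, by simp [crossing]⟩
          · obtain rfl : j = c := by omega
            refine ⟨j, hj, ess m false, ?_⟩
            rw [hfe]
            simp [B, mul_assoc]
        · rcases j with _ | j
          · have : e = true := by simpa using he
            subst this
            exact ⟨0, hj, ess m true, by simp [hfe, crossing]⟩
          · have he' : e = j.bodd := by simpa using he
            subst he'
            exact ⟨j, by omega, 1, by simp [crossing, ← mul_assoc, ess_mul_self]⟩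
      have hgen : ∀ s ∈ Set.range (ess n) ∪ {g | ∃ i q, q < n i ∧ inner n i q = g},
          ∀ g : ThetaRACG n, (∃ j, j < c + 1 ∧ ∃ w, g = crossing n j * f w) →
            ∃ j, j < c + 1 ∧ ∃ w, s * g = crossing n j * f w := by
        rintro s hs _ ⟨j, hj, w, rfl⟩
        obtain ⟨j', hj', w', h⟩ : ∃ j', j' < c + 1 ∧ ∃ w',
            s * crossing n j = crossing n j' * f w' := by
          rcases hs with ⟨e, rfl⟩ | ⟨i, q, hq, rfl⟩
          · exact hess e j hj
          · exact ⟨j, hj, _, hfv i j q hj hq⟩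
        exact ⟨j', hj', w' * w, by rw [← mul_assoc, h, map_mul, mul_assoc]⟩
      have hinv : ∀ s ∈ Set.range (ess n) ∪ {g | ∃ i q, q < n i ∧ inner n i q = g},
          s⁻¹ = s := by
        rintro _ (⟨e, rfl⟩ | ⟨i, q, _, rfl⟩)
        · exact inv_eq_of_mul_eq_one_left (ess_mul_self e)
        · exact inv_eq_of_mul_eq_one_left (inner_mul_self i q)
      intro g
      have hg : g ∈ Subgroup.closure
        (Set.range (ess n) ∪ {g | ∃ i q, q < n i ∧ inner n i q = g}) := by
          rw [closure_generators]; trivial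
      induction hg using Subgroup.closure_induction_left with
      | one => exact ⟨0, by omega, 1, by simp [crossing]⟩
      | mul_left s hs g _ ih => exact hgen s hs g ih
      | inv_mul_cancel s hs g _ ih => rw [hinv s hs]; exact hgen s hs g ih
    have : Finite (ThetaRACG n ⧸ f.range) := by
      refine Finite.of_surjective
        (fun j : Fin (c + 1) => (QuotientGroup.mk (crossing n j) : ThetaRACG n ⧸ f.range)) ?_
      intro q
      obtain ⟨g, rfl⟩ := QuotientGroup.mk_surjective q
      obtain ⟨j, hj, w, rfl⟩ := hcover g
      refine ⟨⟨j, hj⟩, ?_⟩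
      rw [QuotientGroup.eq]
      exact ⟨w, by simp⟩
    exact Subgroup.finiteIndex_of_finite_quotient

end ThetaRACG

/-- **Corollary 4.7.** If the Euler characteristic vectors of two generalized Θ-graphs
(with entries `χᵢ = (1 − nᵢ)/4`) are commensurable vectors — i.e. `K(nᵢ − 1) = L(n'_{σ i} − 1)`
for some positive integers `K, L` and a permutation `σ` — then the right-angled Coxeter
groups `W_{Θ(n₁,…,n_k)}` and `W_{Θ(n'₁,…,n'_k)}` are abstractly commensurable. -/
theorem thetaRACG_commensurable_of_commensurable_vectors
    (k : ℕ) (hk : 3 ≤ k) (n n' : Fin k → ℕ) (hn : ∀ i, 1 ≤ n i) (hn' : ∀ i, 1 ≤ n' i)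
    (K L : ℕ) (hK : 0 < K) (hL : 0 < L) (σ : Equiv.Perm (Fin k))
    (hcom : ∀ i, K * (n i - 1) = L * (n' (σ i) - 1)) :
    AbstractlyCommensurable (ThetaRACG n) (ThetaRACG n') := by
  let m : Fin k → ℕ := fun i => 1 + K * (n i - 1)
  obtain ⟨f, hf, hf'⟩ := ThetaRACG.exists_embedding n m hn K hK 1 (fun _ => rfl)
  obtain ⟨g, hg, hg'⟩ := ThetaRACG.exists_embedding n' m hn' L hL σ.symm (fun i => by
    simp only [m, hcom, σ.apply_symm_apply])
  exact ⟨f.range, g.range, hf', hg',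
    ⟨(MonoidHom.ofInjective hf).symm.trans (MonoidHom.ofInjective hg)⟩⟩
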